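/- Let f, g and h be entire functions given by everywhere absolutely convergent vector valued Dirichlet series, and let p ≥ 0, q ≥ 0, m ≥ 0 be integers. Assume 0 < λ_h^{(m,q)}(f) ≤ ρ_h^{(m,q)}(f) < +∞, 0 < λ_h^{(m,p)}(g) = ρ_h^{(m,p)}(g) < +∞, and that the indicators Δ_h^{(m,q)}(f), Δ̄_h^{(m,q)}(f), Δ_h^{(m,p)}(g), Δ̄_h^{(m,p)}(g), τ_h^{(m,q)}(f), τ̄_h^{(m,q)}(f), τ_h^{(m,p)}(g), τ̄_h^{(m,p)}(g) are all positive and finite. Then: (Δ̄_h^{(m,q)}(f)/Δ_h^{(m,p)}(g))^{1/ρ_h^{(m,p)}(g)} ≤ Δ̄_g^{(p,q)}(f) ≤ min{ (Δ̄_h^{(m,q)}(f)/Δ̄_h^{(m,p)}(g))^{1/ρ_h^{(m,p)}(g)}, (Δ_h^{(m,q)}(f)/Δ_h^{(m,p)}(g))^{1/ρ_h^{(m,p)}(g)} } ≤ max{ (Δ̄_h^{(m,q)}(f)/Δ̄_h^{(m,p)}(g))^{1/ρ_h^{(m,p)}(g)}, (Δ_h^{(m,q)}(f)/Δ_h^{(m,p)}(g))^{1/ρ_h^{(m,p)}(g)}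 } ≤ Δ_g^{(p,q)}(f) ≤ (Δ_h^{(m,q)}(f)/Δ̄_h^{(m,p)}(g))^{1/ρ_h^{(m,p)}(g)}; and (τ_h^{(m,q)}(f)/τ̄_h^{(m,p)}(g))^{1/λ_h^{(m,p)}(g)} ≤ τ_g^{(p,q)}(f) ≤ min{ (τ_h^{(m,q)}(f)/τ_h^{(m,p)}(g))^{1/λ_h^{(m,p)}(g)}, (τ̄_h^{(m,q)}(f)/τ̄_h^{(m,p)}(g))^{1/λ_h^{(m,p)}(g)} } ≤ max{ (τ_h^{(m,q)}(f)/τ_h^{(m,p)}(g))^{1/λ_h^{(m,p)}(g)}, (τ̄_h^{(m,q)}(f)/τ̄_h^{(m,p)}(g))^{1/λ_h^{(m,p)}(g)} } ≤ τ̄_g^{(p,q)}(f) ≤ (τ̄_h^{(m,q)}(f)/τ_h^{(m,p)}(g))^{1/λ_h^{(m,p)}(g)}. -/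

import Mathlib

open Filter Topology

noncomputable section

/-- An entire function given by an everywhere absolutely convergent
vector valued Dirichlet series, with coefficients in a Banach space `E`. -/
structure VVDS (E : Type*) [NormedAddCommGroup E] [NormedSpace ℂ E] [CompleteSpace E] where
  a : ℕ → E
  lam : ℕ → ℝ
  lam_pos : ∀ n, 0 < lam n
  lam_strictMono : StrictMono lam
  lam_tendsto : Tendsto lam atTop atTop
  log_index_bound : ∃ D : ℝ, ∀ᶠ n : ℕ in atTop, Real.log (n : ℝ) / lam n ≤ D
  coeff_decay : Tendsto (fun n => Real.log ‖a n‖ / lam n) atTop atBot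
  abs_conv : ∀ s : ℂ, Summable (fun n => Real.exp (s.re * lam n) * ‖a n‖)

variable {E F G : Type*} [NormedAddCommGroup E] [NormedSpace ℂ E] [CompleteSpace E]
  [NormedAddCommGroup F] [NormedSpace ℂ F] [CompleteSpace F]
  [NormedAddCommGroup G] [NormedSpace ℂ G] [CompleteSpace G]

/-- The entire function defined by the vector valued Dirichlet series. -/
def VVDS.toFun (f : VVDS E) (s : ℂ) : E := ∑' n, Complex.exp (s * (f.lam n : ℂ)) • f.a n

/-- The maximum modulus function `M_f(σ) = sup_t ‖f(σ+it)‖`. -/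
def VVDS.M (f : VVDS E) (σ : ℝ) : ℝ := ⨆ t : ℝ, ‖f.toFun ((σ : ℂ) + (t : ℂ) * Complex.I)‖

/-- The inverse function of the maximum modulus function. -/
def VVDS.Minv (f : VVDS E) (y : ℝ) : ℝ := sInf {σ : ℝ | y ≤ f.M σ}

/-- The (p,q)-th relative Ritt order of `f` with respect to `g`. -/
def relRittOrder (p q : ℕ) (f : VVDS E) (g : VVDS F) : EReal :=
  limsup (fun σ : ℝ =>
    ((Real.log^[p] (g.Minv (f.M σ)) / Real.log^[q] σ : ℝ) : EReal)) atTop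

/-- The (p,q)-th relative Ritt lower order of `f` with respect to `g`. -/
def relRittLowerOrder (p q : ℕ) (f : VVDS E) (g : VVDS F) : EReal :=
  liminf (fun σ : ℝ =>
    ((Real.log^[p] (g.Minv (f.M σ)) / Real.log^[q] σ : ℝ) : EReal)) atTop

/-- The (p,q)-th relative Ritt type of `f` with respect to `g`. -/
def relRittType (p q : ℕ) (f : VVDS E) (g : VVDS F) : EReal :=
  limsup (fun σ : ℝ =>
    ((Real.log^[p-1] (g.Minv (f.M σ)) /
      (Real.log^[q-1] σ) ^ (relRittOrder p q f g).toReal : ℝ) : EReal)) atTop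

/-- The (p,q)-th relative Ritt lower type of `f` with respect to `g`. -/
def relRittLowerType (p q : ℕ) (f : VVDS E) (g : VVDS F) : EReal :=
  liminf (fun σ : ℝ =>
    ((Real.log^[p-1] (g.Minv (f.M σ)) /
      (Real.log^[q-1] σ) ^ (relRittOrder p q f g).toReal : ℝ) : EReal)) atTop

/-- The (p,q)-th relative Ritt weak type of `f` with respect to `g`. -/
def relRittWeakType (p q : ℕ) (f : VVDS E) (g : VVDS F) : EReal :=
  liminf (fun σ : ℝ =>
    ((Real.log^[p-1] (g.Minv (f.M σ)) /
      (Real.log^[q-1] σ) ^ (relRittLowerOrder p q f g).toReal : ℝ) : EReal)) atTop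

/-- The growth indicator `τ̄_g^{(p,q)}(f)`. -/
def relRittUpperWeakType (p q : ℕ) (f : VVDS E) (g : VVDS F) : EReal :=
  limsup (fun σ : ℝ =>
    ((Real.log^[p-1] (g.Minv (f.M σ)) /
      (Real.log^[q-1] σ) ^ (relRittLowerOrder p q f g).toReal : ℝ) : EReal)) atTop


lemma VVDS.norm_term (f : VVDS E) (s : ℂ) (n : ℕ) :
    ‖Complex.exp (s * (f.lam n : ℂ)) • f.a n‖ = Real.exp (s.re * f.lam n) * ‖f.a n‖ := by
  rw [norm_smul, Complex.norm_exp]; simp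

lemma VVDS.summable_re (f : VVDS E) (σ : ℝ) :
    Summable (fun n => Real.exp (σ * f.lam n) * ‖f.a n‖) := by
  simpa using f.abs_conv (σ : ℂ)

lemma VVDS.summable_term (f : VVDS E) (s : ℂ) :
    Summable (fun n => Complex.exp (s * (f.lam n : ℂ)) • f.a n) := by
  apply Summable.of_norm
  simp only [f.norm_term]
  exact f.abs_conv s

/-- The majorant. -/
def VVDS.S (f : VVDS E) (σ : ℝ) : ℝ := ∑' n, Real.exp (σ * f.lam n) * ‖f.a n‖

lemma VVDS.norm_toFun_le_S (f : VVDS E) (s : ℂ) : ‖f.toFun s‖ ≤ f.S s.re := by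
  unfold VVDS.toFun VVDS.S
  refine tsum_of_norm_bounded (f.summable_re s.re).hasSum ?_
  intro n
  exact (f.norm_term s n).le

lemma VVDS.S_mono (f : VVDS E) : Monotone f.S := by
  intro x y hxy
  refine Summable.tsum_le_tsum ?_ (f.summable_re x) (f.summable_re y)
  intro n
  have := f.lam_pos n
  gcongr

lemma VVDS.bdd (f : VVDS E) (σ : ℝ) :
    BddAbove (Set.range fun t : ℝ => ‖f.toFun ((σ : ℂ) + (t : ℂ) * Complex.I)‖) := by
  refine ⟨f.S σ, ?_⟩
  rintro _ ⟨t, rfl⟩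
  simpa using f.norm_toFun_le_S ((σ : ℂ) + (t : ℂ) * Complex.I)

lemma VVDS.norm_toFun_le_M (f : VVDS E) (s : ℂ) : ‖f.toFun s‖ ≤ f.M s.re := by
  have := le_ciSup (f.bdd s.re) s.im
  simp only [Complex.re_add_im] at this
  exact this

lemma VVDS.M_nonneg (f : VVDS E) (σ : ℝ) : 0 ≤ f.M σ :=
  Real.iSup_nonneg fun _ => norm_nonneg _

lemma VVDS.M_le_of (f : VVDS E) (σ B : ℝ) (h : ∀ s : ℂ, s.re = σ → ‖f.toFun s‖ ≤ B) :
    f.M σ ≤ B := by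
  refine ciSup_le fun t => h _ (by simp)

lemma VVDS.M_le_S (f : VVDS E) (σ : ℝ) : f.M σ ≤ f.S σ :=
  f.M_le_of _ _ fun s hs => hs ▸ f.norm_toFun_le_S s

lemma VVDS.S_tendsto (f : VVDS E) : Tendsto f.S atBot (𝓝 0) := by
  have : Tendsto f.S atBot (𝓝 (∑' _ : ℕ, (0 : ℝ))) := by
    refine tendsto_tsum_of_dominated_convergence (f.summable_re 0) ?_ ?_
    · intro n
      have h1 : Tendsto (fun σ : ℝ => σ * f.lam n) atBot atBot :=
        tendsto_id.atBot_mul_const (f.lam_pos n)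
      simpa using (Real.tendsto_exp_atBot.comp h1).mul_const ‖f.a n‖
    · filter_upwards [eventually_le_atBot (0 : ℝ)] with σ hσ n
      have := f.lam_pos n
      rw [Real.norm_of_nonneg (by positivity)]
      gcongr
  simpa using this

lemma VVDS.M_tendsto_zero (f : VVDS E) : Tendsto f.M atBot (𝓝 0) :=
  squeeze_zero f.M_nonneg f.M_le_S f.S_tendsto

lemma VVDS.exists_ne (f : VVDS E) : ∃ n, f.a n ≠ 0 := by
  have := f.coeff_decay.eventually (eventually_lt_atBot (0 : ℝ))
  obtain ⟨n, hn⟩ := this.exists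
  refine ⟨n, fun h => ?_⟩
  simp [h] at hn

lemma VVDS.not_zero (f : VVDS E) (R : ℝ) : ¬ ∀ σ : ℝ, σ < R → f.toFun (σ : ℂ) = 0 := by
  intro h0
  classical
  have hex := f.exists_ne
  set k := Nat.find hex with hk
  have hk1 : f.a k ≠ 0 := Nat.find_spec hex
  have hk2 : ∀ n < k, f.a n = 0 := fun n hn => by
    simpa using Nat.find_min hex hn
  let u : ℝ → ℕ → E := fun σ n => Complex.exp ((σ : ℂ) * ((f.lam n - f.lam k : ℝ) : ℂ)) • f.a n
  have hu : ∀ σ, ∑' n, u σ n = Complex.exp (-(σ : ℂ) * (f.lam k : ℂ)) • f.toFun σ := by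
    intro σ
    unfold VVDS.toFun
    rw [← (f.summable_term σ).tsum_const_smul]
    congr 1
    ext n
    simp only [u, smul_smul, ← Complex.exp_add]
    congr 2
    push_cast; ring
  have hlim : Tendsto (fun σ => ∑' n, u σ n) atBot (𝓝 (∑' n, if n = k then f.a k else 0)) := by
    refine tendsto_tsum_of_dominated_convergence (bound := fun n => ‖f.a n‖) ?_ ?_ ?_
    · simpa using f.summable_re 0
    · intro n
      rcases lt_trichotomy n k with hn | hn | hn
      · simp [u, hk2 n hn, hn.ne]
      · subst hn; simp [u]
      · simp only [hn.ne', if_false]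
        rw [tendsto_zero_iff_norm_tendsto_zero]
        have h1 : Tendsto (fun σ : ℝ => σ * (f.lam n - f.lam k)) atBot atBot :=
          tendsto_id.atBot_mul_const (sub_pos.2 (f.lam_strictMono hn))
        have := (Real.tendsto_exp_atBot.comp h1).mul_const ‖f.a n‖
        rw [zero_mul] at this
        refine this.congr fun σ => ?_
        simp only [u, norm_smul, Complex.norm_exp]
        simp
    · filter_upwards [eventually_le_atBot (0 : ℝ)] with σ hσ n
      rcases lt_or_ge n k with hn | hn
      · simp [u, hk2 n hn]
      · simp only [u, norm_smul, Complex.norm_exp]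
        have : σ * (f.lam n - f.lam k) ≤ 0 :=
          mul_nonpos_of_nonpos_of_nonneg hσ (sub_nonneg.2 (f.lam_strictMono.monotone hn))
        refine mul_le_of_le_one_left (norm_nonneg _) ?_
        rw [← Complex.ofReal_mul, Complex.ofReal_re]
        exact Real.exp_le_one_iff.2 this
  rw [tsum_ite_eq] at hlim
  have h2 : Tendsto (fun σ => ∑' n, u σ n) atBot (𝓝 0) := by
    refine tendsto_const_nhds.congr' ?_
    filter_upwards [eventually_lt_atBot R] with σ hσ
    rw [hu, h0 σ hσ, smul_zero]
  exact hk1 (tendsto_nhds_unique hlim h2)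

lemma VVDS.differentiable (f : VVDS E) : Differentiable ℂ f.toFun := by
  intro s
  have hU : IsOpen {w : ℂ | w.re < s.re + 1} := isOpen_lt Complex.continuous_re continuous_const
  have := Complex.differentiableOn_tsum_of_summable_norm (U := {w : ℂ | w.re < s.re + 1})
    (F := fun n (w : ℂ) => Complex.exp (w * (f.lam n : ℂ)) • f.a n) (f.summable_re (s.re + 1))
    (fun n => by
      apply Differentiable.differentiableOn
      fun_prop) hU
    (fun n w hw => by
      rw [f.norm_term]
      have := f.lam_pos n
      have hw' : w.re ≤ s.re + 1 := le_of_lt hw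
      gcongr)
  exact this.differentiableAt (hU.mem_nhds (by simp))

lemma VVDS.three_lines (f : VVDS E) {x y z : ℝ} (hxy : x ≤ y) (hyz : y ≤ z) (hxz : x < z) :
    f.M y ≤ f.M x ^ (1 - (y - x) / (z - x)) * f.M z ^ ((y - x) / (z - x)) := by
  refine f.M_le_of _ _ fun s hs => ?_
  rw [← hs]
  refine Complex.HadamardThreeLines.norm_le_interp_of_mem_verticalClosedStrip' hxz ?_
    f.differentiable.diffContOnCl ?_ ?_ ?_
  · simp [Complex.HadamardThreeLines.verticalClosedStrip, hs, hxy, hyz]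
  · refine ⟨f.S z, ?_⟩
    rintro _ ⟨w, hw, rfl⟩
    exact (f.norm_toFun_le_S w).trans (f.S_mono hw.2)
  · intro w hw
    have : w.re = x := hw
    exact this ▸ f.norm_toFun_le_M w
  · intro w hw
    have : w.re = z := hw
    exact this ▸ f.norm_toFun_le_M w

lemma VVDS.M_pos (f : VVDS E) (z : ℝ) : 0 < f.M z := by
  refine (f.M_nonneg z).lt_of_ne' fun h => f.not_zero z fun σ hσ => ?_
  have := f.three_lines (x := σ - 1) (y := σ) (z := z) (by linarith) hσ.le (by linarith)
  rw [h, Real.zero_rpow (by have : z - (σ - 1) ≠ 0 := by linarith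
                            simp [this]), mul_zero] at this
  have h2 := f.norm_toFun_le_M (σ : ℂ)
  simp only [Complex.ofReal_re] at h2
  exact norm_le_zero_iff.1 (h2.trans this)

lemma VVDS.M_strictMono (f : VVDS E) : StrictMono f.M := by
  intro y z hyz
  by_contra hcon
  push Not at hcon
  have hz := f.M_pos z
  obtain ⟨x, hx1, hx2⟩ := ((f.M_tendsto_zero.eventually (gt_mem_nhds hz)).and
    (eventually_lt_atBot y)).exists
  have h3 := f.three_lines hx2.le hyz.le (hx2.trans hyz)
  set t := (y - x) / (z - x) with ht
  have ht1 : t < 1 := by rw [ht, div_lt_one (by linarith)]; linarith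
  have h4 : f.M x ^ (1 - t) < f.M z ^ (1 - t) :=
    Real.rpow_lt_rpow (f.M_nonneg x) hx1 (by linarith)
  have h5 : f.M x ^ (1 - t) * f.M z ^ t < f.M z ^ (1 - t) * f.M z ^ t := by
    gcongr
  rw [← Real.rpow_add hz] at h5
  simp at h5
  linarith

lemma VVDS.M_tendsto (f : VVDS E) : Tendsto f.M atTop atTop := by
  refine f.M_strictMono.monotone.tendsto_atTop_atTop ?_
  by_contra hcon
  push Not at hcon
  obtain ⟨B, hB⟩ := hcon
  have h01 : f.M 0 < f.M 1 := f.M_strictMono one_pos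
  have hp := f.M_pos 0
  have hBp : 0 < B := hp.trans (hB 0)
  have key : ∀ᶠ z : ℝ in atTop, f.M 1 ≤ f.M 0 ^ (1 - 1 / z) * B ^ (1 / z) := by
    filter_upwards [eventually_ge_atTop (1 : ℝ)] with z hz
    have := f.three_lines (x := 0) (y := 1) (z := z) zero_le_one hz (by linarith)
    simp only [sub_zero] at this
    refine this.trans ?_
    have hb := (hB z).le
    have := f.M_nonneg z
    gcongr
  have hinv : Tendsto (fun z : ℝ => 1 / z) atTop (𝓝 0) := by
    simpa using tendsto_inv_atTop_zero (𝕜 := ℝ)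
  have hl : Tendsto (fun z : ℝ => f.M 0 ^ (1 - 1 / z) * B ^ (1 / z)) atTop
      (𝓝 (f.M 0 ^ (1 - 0 : ℝ) * B ^ (0 : ℝ))) := by
    refine Tendsto.mul ?_ ?_
    · exact (tendsto_const_nhds).rpow (tendsto_const_nhds.sub hinv) (Or.inl hp.ne')
    · exact (tendsto_const_nhds).rpow hinv (Or.inl hBp.ne')
  simp only [sub_zero, Real.rpow_one, Real.rpow_zero, mul_one] at hl
  have := ge_of_tendsto hl key
  linarith

lemma VVDS.M_continuous (f : VVDS E) : Continuous f.M := by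
  rw [continuous_iff_continuousAt]
  intro x
  let d : ℝ → ℝ := fun y => ∑' n, |Real.exp (y * f.lam n) - Real.exp (x * f.lam n)| * ‖f.a n‖
  have hsum : ∀ y, Summable (fun n => |Real.exp (y * f.lam n) - Real.exp (x * f.lam n)| * ‖f.a n‖) := by
    intro y
    refine Summable.of_nonneg_of_le (fun n => by positivity) (fun n => ?_)
      ((f.summable_re y).add (f.summable_re x))
    rw [← add_mul]
    gcongr
    refine (abs_sub _ _).trans ?_
    simp
  have hd : Tendsto d (𝓝 x) (𝓝 0) := by
    have : Tendsto d (𝓝 x) (𝓝 (∑' _ : ℕ, (0 : ℝ))) := by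
      refine tendsto_tsum_of_dominated_convergence
        ((f.summable_re (x + 1)).add (f.summable_re x)) ?_ ?_
      · intro n
        have : Continuous fun y : ℝ =>
          |Real.exp (y * f.lam n) - Real.exp (x * f.lam n)| * ‖f.a n‖ := by fun_prop
        simpa using this.tendsto x
      · filter_upwards [eventually_le_nhds (show x < x + 1 by linarith)] with y hy n
        have := f.lam_pos n
        rw [Real.norm_of_nonneg (by positivity), ← add_mul]
        gcongr
        refine (abs_sub _ _).trans ?_
        simp only [Real.abs_exp]
        gcongr
    simpa using this
  have hpt : ∀ y t : ℝ, ‖f.toFun ((y : ℂ) + t * Complex.I) - f.toFun ((x : ℂ) + t * Complex.I)‖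
      ≤ d y := by
    intro y t
    unfold VVDS.toFun
    rw [← (f.summable_term _).tsum_sub (f.summable_term _)]
    refine tsum_of_norm_bounded (hsum y).hasSum fun n => ?_
    rw [← sub_smul, norm_smul]
    gcongr
    have : ∀ w : ℝ, Complex.exp (((w : ℂ) + t * Complex.I) * f.lam n)
        = (Real.exp (w * f.lam n) : ℂ) * Complex.exp ((t * f.lam n : ℝ) * Complex.I) := by
      intro w
      rw [Complex.ofReal_exp, ← Complex.exp_add]
      congr 1
      push_cast; ring
    rw [this, this, ← sub_mul, norm_mul, Complex.norm_exp_ofReal_mul_I, mul_one,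
      ← Complex.ofReal_sub, Complex.norm_real, Real.norm_eq_abs]
  have h1 : ∀ y, f.M y ≤ f.M x + d y := by
    intro y
    refine ciSup_le fun t => ?_
    have a1 := le_ciSup (f.bdd x) t
    have a2 := norm_le_norm_add_norm_sub' (f.toFun ((y : ℂ) + t * Complex.I))
      (f.toFun ((x : ℂ) + t * Complex.I))
    have a3 := hpt y t
    change _ ≤ f.M x at a1
    linarith
  have h2 : ∀ y, f.M x ≤ f.M y + d y := by
    intro y
    refine ciSup_le fun t => ?_
    have a1 := le_ciSup (f.bdd y) t
    have a2 := norm_le_norm_add_norm_sub (f.toFun ((y : ℂ) + t * Complex.I))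
      (f.toFun ((x : ℂ) + t * Complex.I))
    have a3 := hpt y t
    change _ ≤ f.M y at a1
    linarith
  rw [ContinuousAt, tendsto_iff_norm_sub_tendsto_zero]
  refine squeeze_zero (fun _ => norm_nonneg _) (fun y => ?_) hd
  rw [Real.norm_eq_abs, abs_le]
  constructor <;> linarith [h1 y, h2 y]

lemma VVDS.Minv_M (g : VVDS F) (σ : ℝ) : g.Minv (g.M σ) = σ := by
  unfold VVDS.Minv
  have : {x : ℝ | g.M σ ≤ g.M x} = Set.Ici σ := by
    ext x; simp [g.M_strictMono.le_iff_le]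
  rw [this, csInf_Ici]

lemma VVDS.exists_M_eq (g : VVDS F) {y : ℝ} (hy : 0 < y) : ∃ σ, g.M σ = y := by
  obtain ⟨x, hx⟩ := (g.M_tendsto_zero.eventually (gt_mem_nhds hy)).exists
  obtain ⟨z, hz⟩ := (g.M_tendsto.eventually (eventually_ge_atTop y)).exists
  exact mem_range_of_exists_le_of_exists_ge g.M_continuous ⟨x, le_of_lt hx⟩ ⟨z, hz⟩

lemma VVDS.M_Minv (g : VVDS F) {y : ℝ} (hy : 0 < y) : g.M (g.Minv y) = y := by
  obtain ⟨σ, rfl⟩ := g.exists_M_eq hy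
  rw [g.Minv_M]

lemma map_u (f : VVDS E) (g : VVDS F) : map (fun σ => g.Minv (f.M σ)) atTop = atTop := by
  have hmono : StrictMono (fun σ => g.Minv (f.M σ)) := by
    intro x y hxy
    have := f.M_strictMono hxy
    rw [← g.M_Minv (f.M_pos x), ← g.M_Minv (f.M_pos y)] at this
    exact g.M_strictMono.lt_iff_lt.1 this
  have hsurj : Function.Surjective (fun σ => g.Minv (f.M σ)) := by
    intro x
    obtain ⟨σ, hσ⟩ := f.exists_M_eq (g.M_pos x)
    exact ⟨σ, by simp only [hσ, g.Minv_M]⟩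
  exact (hmono.orderIsoOfSurjective _ hsurj).map_atTop

section limits
variable {ι : Type*} {l : Filter ι}

lemma coe_eq_of_pos {x : EReal} (h0 : 0 < x) (h1 : x < ⊤) :
    ∃ r : ℝ, 0 < r ∧ x = (r : EReal) := by
  lift x to ℝ using ⟨h1.ne, ((EReal.bot_lt_zero).trans h0).ne'⟩
  exact ⟨x, by exact_mod_cast h0, rfl⟩

lemma ev_lt_of_limsup {F : ι → ℝ} {a c : ℝ}
    (h : limsup (fun i => (F i : EReal)) l = a) (hc : a < c) : ∀ᶠ i in l, F i < c := by
  have : limsup (fun i => (F i : EReal)) l < c := by rw [h]; exact_mod_cast hc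
  filter_upwards [eventually_lt_of_limsup_lt this] with i hi
  exact_mod_cast hi

lemma ev_gt_of_liminf {F : ι → ℝ} {a c : ℝ}
    (h : liminf (fun i => (F i : EReal)) l = a) (hc : c < a) : ∀ᶠ i in l, c < F i := by
  have : c < liminf (fun i => (F i : EReal)) l := by rw [h]; exact_mod_cast hc
  filter_upwards [eventually_lt_of_lt_liminf this] with i hi
  exact_mod_cast hi

lemma limsup_le_of_ev {F : ι → ℝ} {a c : ℝ} (h : limsup (fun i => (F i : EReal)) l = a)
    (hc : ∀ᶠ i in l, F i ≤ c) : a ≤ c := by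
  have : limsup (fun i => (F i : EReal)) l ≤ c := by
    refine limsup_le_of_le (by isBoundedDefault) ?_
    filter_upwards [hc] with i hi
    exact_mod_cast hi
  rw [h] at this; exact_mod_cast this

lemma le_liminf_of_ev {F : ι → ℝ} {a c : ℝ} (h : liminf (fun i => (F i : EReal)) l = a)
    (hc : ∀ᶠ i in l, c ≤ F i) : c ≤ a := by
  have : c ≤ liminf (fun i => (F i : EReal)) l := by
    refine le_liminf_of_le (by isBoundedDefault) ?_
    filter_upwards [hc] with i hi
    exact_mod_cast hi
  rw [h] at this; exact_mod_cast this

/-- `c ≤ liminf T` from: for every `r` with `0 < r < c` eventually `r ≤ T`. -/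
lemma le_liminf_aux [l.NeBot] {T : ι → ℝ} {c : ℝ} (hc : 0 < c)
    (h : ∀ r, 0 < r → r < c → ∀ᶠ i in l, r ≤ T i) :
    (c : EReal) ≤ liminf (fun i => (T i : EReal)) l := by
  refine le_of_forall_lt fun x hx => ?_
  obtain ⟨r, hr1, hr2⟩ := EReal.lt_iff_exists_real_btwn.1 hx
  have hr2 : r < c := by exact_mod_cast hr2
  have h3 := h (max r (c / 2)) (by positivity) (max_lt hr2 (by linarith))
  refine hr1.trans_le (le_liminf_of_le (by isBoundedDefault) ?_)
  filter_upwards [h3] with i hi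
  exact_mod_cast (le_max_left _ _).trans hi

lemma limsup_le_aux [l.NeBot] {T : ι → ℝ} {c : ℝ}
    (h : ∀ r, c < r → ∀ᶠ i in l, T i ≤ r) :
    limsup (fun i => (T i : EReal)) l ≤ c := by
  refine le_of_forall_gt fun x hx => ?_
  obtain ⟨r, hr1, hr2⟩ := EReal.lt_iff_exists_real_btwn.1 hx
  have hr1 : c < r := by exact_mod_cast hr1
  refine lt_of_le_of_lt (limsup_le_of_le (by isBoundedDefault) ?_) hr2
  filter_upwards [h r hr1] with i hi
  exact_mod_cast hi

lemma liminf_le_aux [l.NeBot] {T : ι → ℝ} {c : ℝ}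
    (h : ∀ r, c < r → ¬ ∀ᶠ i in l, r < T i) :
    liminf (fun i => (T i : EReal)) l ≤ c := by
  by_contra hx
  push Not at hx
  obtain ⟨r, hr1, hr2⟩ := EReal.lt_iff_exists_real_btwn.1 hx
  refine h r (by exact_mod_cast hr1) ?_
  filter_upwards [eventually_lt_of_lt_liminf hr2] with i hi
  exact_mod_cast hi

lemma le_limsup_aux [l.NeBot] {T : ι → ℝ} {c : ℝ} (hc : 0 < c)
    (h : ∀ r, 0 < r → r < c → ¬ ∀ᶠ i in l, T i < r) :
    (c : EReal) ≤ limsup (fun i => (T i : EReal)) l := by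
  by_contra hx
  push Not at hx
  obtain ⟨r, hr1, hr2⟩ := EReal.lt_iff_exists_real_btwn.1 hx
  have hr2 : r < c := by exact_mod_cast hr2
  refine h (max r (c / 2)) (by positivity) (max_lt hr2 (by linarith)) ?_
  filter_upwards [eventually_lt_of_limsup_lt hr1] with i hi
  have hi : T i < r := by exact_mod_cast hi
  exact hi.trans_le (le_max_left _ _)

/-- The core comparison lemma: `T = (F/G)^(1/β)`. -/
lemma core [l.NeBot] {F G T : ι → ℝ} {a a' b b' β : ℝ} (hβ : 0 < β)
    (ha' : 0 < a') (ha : 0 < a) (hb' : 0 < b') (hb : 0 < b)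
    (hF : limsup (fun i => (F i : EReal)) l = a) (hF' : liminf (fun i => (F i : EReal)) l = a')
    (hG : limsup (fun i => (G i : EReal)) l = b) (hG' : liminf (fun i => (G i : EReal)) l = b')
    (hT : ∀ᶠ i in l, 0 < T i ∧ F i = G i * T i ^ β) :
    (((a' / b) ^ (1 / β) : ℝ) : EReal) ≤ liminf (fun i => (T i : EReal)) l ∧
    liminf (fun i => (T i : EReal)) l ≤ (((a' / b') ^ (1 / β) : ℝ) : EReal) ∧
    liminf (fun i => (T i : EReal)) l ≤ (((a / b) ^ (1 / β) : ℝ) : EReal) ∧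
    (((a' / b') ^ (1 / β) : ℝ) : EReal) ≤ limsup (fun i => (T i : EReal)) l ∧
    (((a / b) ^ (1 / β) : ℝ) : EReal) ≤ limsup (fun i => (T i : EReal)) l ∧
    limsup (fun i => (T i : EReal)) l ≤ (((a / b') ^ (1 / β) : ℝ) : EReal) := by
  have hFp : ∀ᶠ i in l, 0 < F i := ev_gt_of_liminf hF' ha'
  have hGp : ∀ᶠ i in l, 0 < G i := ev_gt_of_liminf hG' hb'
  -- translation of `r < c^(1/β)`
  have tr1 : ∀ {x y r : ℝ}, 0 < x → 0 < y → 0 < r → r < (x / y) ^ (1 / β) → r ^ β * y < x := by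
    intro x y r hx hy hr h
    rw [one_div, Real.lt_rpow_inv_iff_of_pos hr.le (by positivity) hβ, lt_div_iff₀ hy] at h
    exact h
  have tr2 : ∀ {x y r : ℝ}, 0 < x → 0 < y → (x / y) ^ (1 / β) < r → 0 < r ∧ x < r ^ β * y := by
    intro x y r hx hy h
    have hr : 0 < r := lt_of_le_of_lt (by positivity) h
    rw [one_div, Real.rpow_inv_lt_iff_of_pos (by positivity) hr.le hβ, div_lt_iff₀ hy] at h
    exact ⟨hr, h⟩
  refine ⟨?_, ?_, ?_, ?_, ?_, ?_⟩
  · refine le_liminf_aux (by positivity) fun r hr hrc => ?_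
    have h1 := tr1 ha' hb hr hrc
    have hrb : 0 < r ^ β := by positivity
    obtain ⟨c, hc1, hc2⟩ := exists_between h1
    filter_upwards [hT, hGp, ev_gt_of_liminf hF' hc2,
      ev_lt_of_limsup hG (show b < c / r ^ β by rw [lt_div_iff₀ hrb]; linarith)]
      with i ⟨hi1, hi2⟩ hi3 hi4 hi5
    rw [lt_div_iff₀ hrb] at hi5
    rw [← Real.rpow_le_rpow_iff hr.le hi1.le hβ]
    rw [hi2] at hi4
    exact le_of_mul_le_mul_left (hi5.trans hi4).le hi3
  · refine liminf_le_aux fun r hrc hev => ?_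
    obtain ⟨hr, h1⟩ := tr2 ha' hb' hrc
    have hrb : 0 < r ^ β := by positivity
    obtain ⟨c, hc1, hc2⟩ := exists_between h1
    refine absurd (le_liminf_of_ev hF' (c := c) ?_) (by linarith)
    filter_upwards [hT, hGp, hev,
      ev_gt_of_liminf hG' (show c / r ^ β < b' by rw [div_lt_iff₀ hrb]; linarith)]
      with i ⟨hi1, hi2⟩ hi3 hi4 hi5
    rw [div_lt_iff₀ hrb] at hi5
    rw [hi2]
    have : r ^ β < T i ^ β := Real.rpow_lt_rpow hr.le hi4 hβ
    exact hi5.le.trans (by gcongr)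
  · refine liminf_le_aux fun r hrc hev => ?_
    obtain ⟨hr, h1⟩ := tr2 ha hb hrc
    have hrb : 0 < r ^ β := by positivity
    obtain ⟨c, hc1, hc2⟩ := exists_between h1
    have := limsup_le_of_ev hG (c := c / r ^ β) ?_
    · rw [le_div_iff₀ hrb] at this; linarith
    filter_upwards [hT, hGp, hev, ev_lt_of_limsup hF hc1] with i ⟨hi1, hi2⟩ hi3 hi4 hi5
    rw [le_div_iff₀ hrb]
    have : r ^ β < T i ^ β := Real.rpow_lt_rpow hr.le hi4 hβ
    rw [hi2] at hi5
    refine le_trans ?_ hi5.le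
    gcongr
  · refine le_limsup_aux (by positivity) fun r hr hrc hev => ?_
    have h1 := tr1 ha' hb' hr hrc
    have hrb : 0 < r ^ β := by positivity
    obtain ⟨c, hc1, hc2⟩ := exists_between h1
    have := le_liminf_of_ev hG' (c := c / r ^ β) ?_
    · rw [div_le_iff₀ hrb] at this; linarith
    filter_upwards [hT, hGp, hev, ev_gt_of_liminf hF' hc2] with i ⟨hi1, hi2⟩ hi3 hi4 hi5
    rw [div_le_iff₀ hrb]
    have : T i ^ β < r ^ β := Real.rpow_lt_rpow hi1.le hi4 hβ
    rw [hi2] at hi5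
    refine le_trans hi5.le ?_
    gcongr
  · refine le_limsup_aux (by positivity) fun r hr hrc hev => ?_
    have h1 := tr1 ha hb hr hrc
    have hrb : 0 < r ^ β := by positivity
    obtain ⟨c, hc1, hc2⟩ := exists_between h1
    refine absurd (limsup_le_of_ev hF (c := c) ?_) (by linarith)
    filter_upwards [hT, hGp, hev,
      ev_lt_of_limsup hG (show b < c / r ^ β by rw [lt_div_iff₀ hrb]; linarith)]
      with i ⟨hi1, hi2⟩ hi3 hi4 hi5
    rw [lt_div_iff₀ hrb] at hi5
    rw [hi2]
    have : T i ^ β < r ^ β := Real.rpow_lt_rpow hi1.le hi4 hβ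
    refine le_trans ?_ hi5.le
    gcongr
  · refine limsup_le_aux fun r hrc => ?_
    obtain ⟨hr, h1⟩ := tr2 ha hb' hrc
    have hrb : 0 < r ^ β := by positivity
    obtain ⟨c, hc1, hc2⟩ := exists_between h1
    filter_upwards [hT, hGp, ev_lt_of_limsup hF hc1,
      ev_gt_of_liminf hG' (show c / r ^ β < b' by rw [div_lt_iff₀ hrb]; linarith)]
      with i ⟨hi1, hi2⟩ hi3 hi4 hi5
    rw [div_lt_iff₀ hrb] at hi5
    rw [← Real.rpow_le_rpow_iff hi1.le hr.le hβ]
    rw [hi2] at hi4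
    exact le_of_mul_le_mul_left (hi4.trans hi5).le hi3

end limits

lemma tendsto_log_iter (k : ℕ) : Tendsto (Real.log^[k]) atTop atTop := by
  induction k with
  | zero => exact tendsto_id
  | succ k ih =>
    rw [Function.iterate_succ']
    exact Real.tendsto_log_atTop.comp ih

lemma tendsto_u (f : VVDS E) (g : VVDS F) :
    Tendsto (fun σ => g.Minv (f.M σ)) atTop atTop := (map_u f g).le

/-- The comparison lemma for relative growth quotients. -/
lemma compare (f : VVDS E) (g : VVDS F) (h : VVDS G) (p q m : ℕ) {α β a a' b b' : ℝ}
    (hβ : 0 < β) (ha' : 0 < a') (ha : 0 < a) (hb' : 0 < b') (hb : 0 < b)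
    (hF : limsup (fun σ : ℝ =>
      ((Real.log^[m] (h.Minv (f.M σ)) / (Real.log^[q] σ) ^ α : ℝ) : EReal)) atTop = a)
    (hF' : liminf (fun σ : ℝ =>
      ((Real.log^[m] (h.Minv (f.M σ)) / (Real.log^[q] σ) ^ α : ℝ) : EReal)) atTop = a')
    (hG : limsup (fun σ : ℝ =>
      ((Real.log^[m] (h.Minv (g.M σ)) / (Real.log^[p] σ) ^ β : ℝ) : EReal)) atTop = b)
    (hG' : liminf (fun σ : ℝ =>
      ((Real.log^[m] (h.Minv (g.M σ)) / (Real.log^[p] σ) ^ β : ℝ) : EReal)) atTop = b')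
    {T : ℝ → ℝ}
    (hTd : T = fun σ => Real.log^[p] (g.Minv (f.M σ)) / (Real.log^[q] σ) ^ (α / β)) :
    (((a' / b) ^ (1 / β) : ℝ) : EReal) ≤ liminf (fun i => (T i : EReal)) atTop ∧
    liminf (fun i => (T i : EReal)) atTop ≤ (((a' / b') ^ (1 / β) : ℝ) : EReal) ∧
    liminf (fun i => (T i : EReal)) atTop ≤ (((a / b) ^ (1 / β) : ℝ) : EReal) ∧
    (((a' / b') ^ (1 / β) : ℝ) : EReal) ≤ limsup (fun i => (T i : EReal)) atTop ∧
    (((a / b) ^ (1 / β) : ℝ) : EReal) ≤ limsup (fun i => (T i : EReal)) atTop ∧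
    limsup (fun i => (T i : EReal)) atTop ≤ (((a / b') ^ (1 / β) : ℝ) : EReal) := by
  rw [← map_u f g] at hG hG'
  refine core (F := fun σ => Real.log^[m] (h.Minv (f.M σ)) / (Real.log^[q] σ) ^ α)
    (G := fun σ => Real.log^[m] (h.Minv (g.M (g.Minv (f.M σ)))) /
      (Real.log^[p] (g.Minv (f.M σ))) ^ β) hβ ha' ha hb' hb hF hF' hG hG' ?_
  filter_upwards [(tendsto_log_iter q).eventually (eventually_gt_atTop 0),
    ((tendsto_log_iter p).comp (tendsto_u f g)).eventually (eventually_gt_atTop 0)] with σ h1 h2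
  simp only [Function.comp] at h2
  subst hTd
  refine ⟨by positivity, ?_⟩
  rw [g.M_Minv (f.M_pos σ)]
  simp only
  rw [Real.div_rpow h2.le (by positivity), ← Real.rpow_mul h1.le, div_mul_cancel₀ _ hβ.ne']
  have : (Real.log^[p] (g.Minv (f.M σ))) ^ β ≠ 0 := by positivity
  field_simp

lemma order_compare (f : VVDS E) (g : VVDS F) (h : VVDS G) (p q m : ℕ) {a a' b : ℝ}
    (ha' : 0 < a') (ha : 0 < a) (hb : 0 < b)
    (hF : relRittOrder m q f h = a) (hF' : relRittLowerOrder m q f h = a')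
    (hG : relRittOrder m p g h = b) (hG' : relRittLowerOrder m p g h = b) :
    relRittOrder p q f g = ((a / b : ℝ) : EReal) ∧
    relRittLowerOrder p q f g = ((a' / b : ℝ) : EReal) := by
  unfold relRittOrder relRittLowerOrder at *
  have := compare f g h p q m (α := 1) (β := 1) one_pos ha' ha hb hb (by simpa using hF)
    (by simpa using hF') (by simpa using hG) (by simpa using hG') rfl
  simp only [div_one, Real.rpow_one] at this
  obtain ⟨h1, h2, _, _, h5, h6⟩ := this
  exact ⟨le_antisymm h6 h5, le_antisymm h2 h1⟩

theorem stmt_18 (f : VVDS E) (g : VVDS F) (h : VVDS G) (p q m : ℕ)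
    (hf1 : (0 : EReal) < relRittLowerOrder m q f h)
    (hf2 : relRittLowerOrder m q f h ≤ relRittOrder m q f h)
    (hf3 : relRittOrder m q f h < ⊤)
    (hg1 : (0 : EReal) < relRittLowerOrder m p g h)
    (hgr : relRittLowerOrder m p g h = relRittOrder m p g h)
    (hg3 : relRittOrder m p g h < ⊤)
    (hDf1 : (0 : EReal) < relRittType m q f h)
    (hDf2 : relRittType m q f h < ⊤)
    (hDbf1 : (0 : EReal) < relRittLowerType m q f h)
    (hDbf2 : relRittLowerType m q f h < ⊤)
    (htf1 : (0 : EReal) < relRittWeakType m q f h)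
    (htf2 : relRittWeakType m q f h < ⊤)
    (htbf1 : (0 : EReal) < relRittUpperWeakType m q f h)
    (htbf2 : relRittUpperWeakType m q f h < ⊤)
    (hDg1 : (0 : EReal) < relRittType m p g h)
    (hDg2 : relRittType m p g h < ⊤)
    (hDbg1 : (0 : EReal) < relRittLowerType m p g h)
    (hDbg2 : relRittLowerType m p g h < ⊤)
    (htg1 : (0 : EReal) < relRittWeakType m p g h)
    (htg2 : relRittWeakType m p g h < ⊤)
    (htbg1 : (0 : EReal) < relRittUpperWeakType m p g h)
    (htbg2 : relRittUpperWeakType m p g h < ⊤)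
    :
    ((((((relRittLowerType m q f h).toReal / (relRittType m p g h).toReal) ^ (1 / (relRittOrder m p g h).toReal)) : ℝ) : EReal) ≤ relRittLowerType p q f g ∧ relRittLowerType p q f g ≤ ((min (((relRittLowerType m q f h).toReal / (relRittLowerType m p g h).toReal) ^ (1 / (relRittOrder m p g h).toReal)) (((relRittType m q f h).toReal / (relRittType m p g h).toReal) ^ (1 / (relRittOrder m p g h).toReal)) : ℝ) : EReal) ∧ ((min (((relRittLowerType m q f h).toReal / (relRittLowerType m p g h).toReal) ^ (1 / (relRittOrder m p g h).toReal)) (((relRittType m q f h).toReal / (relRittType m p g h).toReal) ^ (1 / (relRittOrder m p g h).toReal)) : ℝ) : EReal) ≤ ((max (((relRittLowerType m q f h).toReal / (relRittLowerType m p g h).toReal) ^ (1 / (relRittOrder m p g h).toReal)) (((relRittType m q f h).toReal / (relRittType m p g h).toReal) ^ (1 / (relRittOrder m p g h).toReal)) : ℝ) : EReal) ∧ ((max (((relRittLowerType m q f h).toReal / (relRittLowerType m p g h).toReal) ^ (1 / (relRittOrder m p g h).toReal)) (((relRittType m q f h).toReal / (relRittType m p g h).toReal) ^ (1 / (relRittOrder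 m p g h).toReal)) : ℝ) : EReal) ≤ relRittType p q f g ∧ relRittType p q f g ≤ (((((relRittType m q f h).toReal / (relRittLowerType m p g h).toReal) ^ (1 / (relRittOrder m p g h).toReal)) : ℝ) : EReal)) ∧ ((((((relRittWeakType m q f h).toReal / (relRittUpperWeakType m p g h).toReal) ^ (1 / (relRittLowerOrder m p g h).toReal)) : ℝ) : EReal) ≤ relRittWeakType p q f g ∧ relRittWeakType p q f g ≤ ((min (((relRittWeakType m q f h).toReal / (relRittWeakType m p g h).toReal) ^ (1 / (relRittLowerOrder m p g h).toReal)) (((relRittUpperWeakType m q f h).toReal / (relRittUpperWeakType m p g h).toReal) ^ (1 / (relRittLowerOrder m p g h).toReal)) : ℝ) : EReal) ∧ ((min (((relRittWeakType m q f h).toReal / (relRittWeakType m p g h).toReal) ^ (1 / (relRittLowerOrder m p g h).toReal)) (((relRittUpperWeakType m q f h).toReal / (relRittUpperWeakType m p g h).toReal) ^ (1 / (relRittLowerOrder m p g h).toReal)) : ℝ) : EReal) ≤ ((max (((relRittWeakType m q f h).toReal / (relRittWeakType m p g h).toReal) ^ (1 / (relRittLowerOrder m p g h).toReal)) (((relRittUpperWeakType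 m q f h).toReal / (relRittUpperWeakType m p g h).toReal) ^ (1 / (relRittLowerOrder m p g h).toReal)) : ℝ) : EReal) ∧ ((max (((relRittWeakType m q f h).toReal / (relRittWeakType m p g h).toReal) ^ (1 / (relRittLowerOrder m p g h).toReal)) (((relRittUpperWeakType m q f h).toReal / (relRittUpperWeakType m p g h).toReal) ^ (1 / (relRittLowerOrder m p g h).toReal)) : ℝ) : EReal) ≤ relRittUpperWeakType p q f g ∧ relRittUpperWeakType p q f g ≤ (((((relRittUpperWeakType m q f h).toReal / (relRittWeakType m p g h).toReal) ^ (1 / (relRittLowerOrder m p g h).toReal)) : ℝ) : EReal)) := by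
  obtain ⟨a', ha', hea'⟩ := coe_eq_of_pos hf1 (hf2.trans_lt hf3)
  obtain ⟨a, ha, hea⟩ := coe_eq_of_pos (hf1.trans_le hf2) hf3
  obtain ⟨b, hb, heb⟩ := coe_eq_of_pos (hgr ▸ hg1) hg3
  have heb' := hgr.trans heb
  obtain ⟨ho1, ho2⟩ := order_compare f g h p q m ha' ha hb hea hea' heb heb'
  constructor
  · obtain ⟨c, hc, hec⟩ := coe_eq_of_pos hDf1 hDf2
    obtain ⟨c', hc', hec'⟩ := coe_eq_of_pos hDbf1 hDbf2
    obtain ⟨d, hd, hed⟩ := coe_eq_of_pos hDg1 hDg2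
    obtain ⟨d', hd', hed'⟩ := coe_eq_of_pos hDbg1 hDbg2
    rw [hec, hec', hed, hed', heb]
    unfold relRittType relRittLowerType at *
    rw [hea] at hec hec'
    rw [heb] at hed hed'
    rw [ho1]
    simp only [EReal.toReal_coe] at hec hec' hed hed' ⊢
    obtain ⟨h1, h2, h3, h4, h5, h6⟩ :=
      compare f g h (p-1) (q-1) (m-1) hb hc' hc hd' hd hec hec' hed hed' rfl
    refine ⟨h1, ?_, ?_, ?_, h6⟩
    · rw [EReal.coe_strictMono.monotone.map_min]; exact le_min h2 h3
    · exact EReal.coe_le_coe_iff.2 min_le_max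
    · rw [EReal.coe_strictMono.monotone.map_max]; exact max_le h4 h5
  · obtain ⟨c, hc, hec⟩ := coe_eq_of_pos htbf1 htbf2
    obtain ⟨c', hc', hec'⟩ := coe_eq_of_pos htf1 htf2
    obtain ⟨d, hd, hed⟩ := coe_eq_of_pos htbg1 htbg2
    obtain ⟨d', hd', hed'⟩ := coe_eq_of_pos htg1 htg2
    rw [hec, hec', hed, hed', heb']
    unfold relRittWeakType relRittUpperWeakType at *
    rw [hea'] at hec hec'
    rw [heb'] at hed hed'
    rw [ho2]
    simp only [EReal.toReal_coe] at hec hec' hed hed' ⊢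
    obtain ⟨h1, h2, h3, h4, h5, h6⟩ :=
      compare f g h (p-1) (q-1) (m-1) hb hc' hc hd' hd hec hec' hed hed' rfl
    refine ⟨h1, ?_, ?_, ?_, h6⟩
    · rw [EReal.coe_strictMono.monotone.map_min]; exact le_min h2 h3
    · exact EReal.coe_le_coe_iff.2 min_le_max
    · rw [EReal.coe_strictMono.monotone.map_max]; exact max_le h4 h5
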